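/- Intertwining QK=KP: let p=(p_1,…,p_k) with all p_i>0. Let C={x∈ℤ_+^k: x_1≥⋯≥x_k} and define kernels Q(x,y)=(s_y(p)/s_x(p))·1{y−x∈{e_1,…,e_k}} for x,y∈C, K(x,y)=(p^y/s_x(p))·κ_{x,y} for x∈C, y∈ℤ_+^k, and P(y,z)=p^{z−y}·1{z−y∈{e_1,…,e_k}} for y,z∈ℤ_+^k. Then for every x∈C and z∈ℤ_+^k: ∑_{y∈C} Q(x,y)·K(y,z) = ∑_{y∈ℤ_+^k} K(x,y)·P(y,z) (both sums have finitely many nonzero terms). -/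

import Mathlib

/-- The cells of the Young diagram of shape `lam` (row lengths), within the
first `k` rows. -/
def cells (k : ℕ) (lam : ℕ → ℕ) : Finset (ℕ × ℕ) :=
  (Finset.range k ×ˢ Finset.range ((Finset.range k).sup lam)).filter
    (fun rc => rc.2 < lam rc.1)

/-- `T` is a semistandard Young tableau of shape `lam` with entries in
`{0,…,k-1}` (0-based version of entries `{1,…,k}`): rows weakly increase,
columns strictly increase, and `T` vanishes outside the diagram. -/
def IsSSYT (k : ℕ) (lam : ℕ → ℕ) (T : ℕ → ℕ → ℕ) : Prop :=
  (∀ r c, c < lam r → T r c < k) ∧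
  (∀ r c, ¬ c < lam r → T r c = 0) ∧
  (∀ r c c', c ≤ c' → c' < lam r → T r c ≤ T r c') ∧
  (∀ r r' c, r < r' → c < lam r' → T r c < T r' c)

/-- Number of entries of `T` (of shape `lam`, within `k` rows) equal to `i`. -/
def entryCount (k : ℕ) (lam : ℕ → ℕ) (T : ℕ → ℕ → ℕ) (i : ℕ) : ℕ :=
  ((cells k lam).filter (fun rc => T rc.1 rc.2 = i)).card

/-- The Schur polynomial `s_lam(p) = ∑_T p^{weight(T)}`, summing over all
semistandard tableaux of shape `lam` with entries in `{0,…,k-1}`. -/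
noncomputable def schur (k : ℕ) (lam : ℕ → ℕ) (p : ℕ → ℝ) : ℝ :=
  ∑' T : {T : ℕ → ℕ → ℕ // IsSSYT k lam T},
    ∏ i ∈ Finset.range k, p i ^ entryCount k lam T.1 i

/-- The Kostka number `κ_{lam,w}`: the number of semistandard tableaux of shape
`lam` with entries in `{0,…,k-1}` and weight `w`. -/
noncomputable def kostka (k : ℕ) (lam : ℕ → ℕ) (w : ℕ → ℕ) : ℕ :=
  Set.ncard {T : ℕ → ℕ → ℕ | IsSSYT k lam T ∧ ∀ i, i < k → entryCount k lam T i = w i}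

/-- The reversed vector `x^*` of a nonnegative integer vector, as a shape. -/
def revPartZ (k : ℕ) (x : ℕ → ℤ) : ℕ → ℕ :=
  fun j => if j < k then (x (k-1-j)).toNat else 0

/-- `x + e_i`. -/
def addE (x : ℕ → ℕ) (i : ℕ) : ℕ → ℕ := fun j => if j = i then x j + 1 else x j

/-- Membership in `C = {x ∈ ℤ_+^k : x_1 ≥ ⋯ ≥ x_k}` (normalised to vanish from
coordinate `k` on). -/
def isPart (k : ℕ) (x : ℕ → ℕ) : Prop :=
  (∀ j, j + 1 < k → x (j+1) ≤ x j) ∧ (∀ j, k ≤ j → x j = 0)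

/-- Membership in `ℤ_+^k` (normalised to vanish from coordinate `k` on). -/
def isVec (k : ℕ) (x : ℕ → ℕ) : Prop := ∀ j, k ≤ j → x j = 0

open Classical in
/-- The kernel `Q(x,y) = (s_y(p)/s_x(p)) 1{y − x ∈ {e_1,…,e_k}}`. -/
noncomputable def Qker (k : ℕ) (p : ℕ → ℝ) (x y : ℕ → ℕ) : ℝ :=
  (schur k y p / schur k x p) *
    ∑ i ∈ Finset.range k, if y = addE x i then 1 else 0

/-- The kernel `K(x,y) = (p^y / s_x(p)) κ_{x,y}`. -/
noncomputable def Kker (k : ℕ) (p : ℕ → ℝ) (x y : ℕ → ℕ) : ℝ :=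
  ((∏ i ∈ Finset.range k, p i ^ y i) / schur k x p) * (kostka k x y : ℝ)

open Classical in
/-- The kernel `P(y,z) = p^{z−y} 1{z − y ∈ {e_1,…,e_k}}`. -/
noncomputable def Pker (k : ℕ) (p : ℕ → ℝ) (y z : ℕ → ℕ) : ℝ :=
  ∑ i ∈ Finset.range k, if z = addE y i then p i else 0

open Classical in
noncomputable def boxF (k N : ℕ) : Finset (ℕ → ℕ) :=
  Finset.univ.image (fun g : Fin k → Fin (N+1) => fun r : ℕ => if h : r < k then (g ⟨r, h⟩ : ℕ) else 0)

lemma mem_boxF (k N : ℕ) (m : ℕ → ℕ) : m ∈ boxF k N ↔ isVec k m ∧ ∀ r, m r ≤ N := by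
  classical
  unfold boxF isVec
  simp only [Finset.mem_image, Finset.mem_univ, true_and]
  constructor
  · rintro ⟨g, rfl⟩
    refine ⟨fun j hj => by simp [hj], fun r => ?_⟩
    by_cases h : r < k
    · simp only [h, dif_pos]; have := (g ⟨r, h⟩).2; omega
    · simp [h]
  · rintro ⟨h1, h2⟩
    refine ⟨fun i => ⟨m i, by have := h2 i; omega⟩, ?_⟩
    funext r
    by_cases h : r < k
    · simp [h]
    · simp [h, h1 r (by omega)]

def Interl (k : ℕ) (m x : ℕ → ℕ) : Prop := ∀ r, r < k → x (r+1) ≤ m r ∧ m r ≤ x r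

lemma isPart.anti {k : ℕ} {x : ℕ → ℕ} (h : isPart k x) : Antitone x := by
  refine antitone_nat_of_succ_le fun n => ?_
  by_cases hn : n + 1 < k
  · exact h.1 n hn
  · rw [h.2 (n+1) (by omega)]; omega

lemma mem_cells (k : ℕ) (lam : ℕ → ℕ) (rc : ℕ × ℕ) :
    rc ∈ cells k lam ↔ rc.1 < k ∧ rc.2 < lam rc.1 := by
  unfold cells
  simp only [Finset.mem_filter, Finset.mem_product, Finset.mem_range]
  constructor
  · rintro ⟨⟨a, b⟩, c⟩; exact ⟨a, c⟩
  · rintro ⟨a, c⟩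
    exact ⟨⟨a, lt_of_lt_of_le c (Finset.le_sup (f := lam) (Finset.mem_range.2 a))⟩, c⟩

lemma card_cells (k : ℕ) (lam : ℕ → ℕ) : (cells k lam).card = ∑ r ∈ Finset.range k, lam r := by
  have : cells k lam = ((Finset.range k).sigma (fun r => Finset.range (lam r))).map
      (Equiv.sigmaEquivProd ℕ ℕ).toEmbedding := by
    ext rc
    simp only [mem_cells, Finset.mem_map_equiv, Finset.mem_sigma, Finset.mem_range]
    simp
  rw [this, Finset.card_map, Finset.card_sigma]
  simp

def extT (k : ℕ) (x m : ℕ → ℕ) (T : ℕ → ℕ → ℕ) : ℕ → ℕ → ℕ :=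
  fun r c => if c < m r then T r c else if c < x r then k else 0

lemma inter_le {k : ℕ} {x m : ℕ → ℕ} (hm : isVec k m) (hi : Interl k m x) (r : ℕ) : m r ≤ x r := by
  by_cases h : r < k
  · exact (hi r h).2
  · rw [hm r (by omega)]; omega

lemma inter_part {k : ℕ} {x m : ℕ → ℕ} (hm : isVec k m) (hi : Interl k m x) : isPart k m :=
  ⟨fun j hj => le_trans (hi (j+1) hj).2 (hi j (by omega)).1, hm⟩

lemma inter_part' {k : ℕ} {x m : ℕ → ℕ} (hx : isVec (k+1) x) (hi : Interl k m x) :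
    isPart (k+1) x :=
  ⟨fun j hj => le_trans (hi j (by omega)).1 (hi j (by omega)).2, hx⟩

lemma extT_ssyt {k : ℕ} {x m : ℕ → ℕ} {T : ℕ → ℕ → ℕ} (hx : isPart (k+1) x) (hm : isVec k m)
    (hi : Interl k m x) (hT : IsSSYT k m T) : IsSSYT (k+1) x (extT k x m T) := by
  obtain ⟨h1, h2, h3, h4⟩ := hT
  have hle := inter_le hm hi
  have hanti := hx.anti
  have hmanti := (inter_part hm hi).anti
  refine ⟨fun r c hc => ?_, fun r c hc => ?_, fun r c c' hcc hc' => ?_, fun r r' c hr hc => ?_⟩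
  · unfold extT
    split_ifs with h
    · have := h1 r c h; omega
    · omega
  · unfold extT
    have := hle r
    rw [if_neg (by omega), if_neg hc]
  · unfold extT
    by_cases h : c' < m r
    · rw [if_pos h, if_pos (by omega)]; exact h3 r c c' hcc h
    · rw [if_neg h, if_pos hc']
      split_ifs with h5 h6
      · exact (h1 r c h5).le
      · exact le_rfl
      · omega
  · unfold extT
    by_cases h : c < m r'
    · have := hmanti hr.le
      rw [if_pos h, if_pos (by omega)]; exact h4 r r' c hr h
    · rw [if_neg h, if_pos hc]
      have hrk : r < k := by
        by_contra hh
        rw [hx.2 r' (by omega)] at hc; omega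
      have : x r' ≤ m r := le_trans (hanti (show r+1 ≤ r' from hr)) (hi r hrk).1
      rw [if_pos (by omega)]
      exact h1 r c (by omega)

lemma extT_lt {k : ℕ} {x m : ℕ → ℕ} {T : ℕ → ℕ → ℕ} (hm : isVec k m)
    (hi : Interl k m x) (hT : IsSSYT k m T) (r c : ℕ) :
    c < m r ↔ c < x r ∧ extT k x m T r c < k := by
  have hle := inter_le hm hi r
  unfold extT
  constructor
  · intro h
    rw [if_pos h]; exact ⟨by omega, hT.1 r c h⟩
  · rintro ⟨h, h'⟩
    by_contra hc
    rw [if_neg hc, if_pos h] at h'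
    omega

lemma entry_lt {k : ℕ} {x m : ℕ → ℕ} {T : ℕ → ℕ → ℕ} (hm : isVec k m)
    (hi : Interl k m x) {i : ℕ} (hik : i < k) :
    entryCount (k+1) x (extT k x m T) i = entryCount k m T i := by
  unfold entryCount
  congr 1
  ext ⟨r, c⟩
  simp only [Finset.mem_filter, mem_cells]
  have hle := inter_le hm hi r
  unfold extT
  constructor
  · rintro ⟨⟨h1, h2⟩, h3⟩
    by_cases h : c < m r
    · rw [if_pos h] at h3
      refine ⟨⟨?_, h⟩, h3⟩
      by_contra hh
      rw [hm r (by omega)] at h; omega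
    · rw [if_neg h, if_pos h2] at h3; omega
  · rintro ⟨⟨h1, h2⟩, h3⟩
    exact ⟨⟨by omega, by omega⟩, by rw [if_pos h2]; exact h3⟩

lemma entry_top {k : ℕ} {x m : ℕ → ℕ} {T : ℕ → ℕ → ℕ} (hm : isVec k m)
    (hi : Interl k m x) (hT : IsSSYT k m T) :
    ∑ r ∈ Finset.range k, m r + entryCount (k+1) x (extT k x m T) k
      = ∑ r ∈ Finset.range (k+1), x r := by
  rw [← card_cells, ← card_cells, entryCount]
  rw [← Finset.card_filter_add_card_filter_not (s := cells (k+1) x)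
    (fun rc => extT k x m T rc.1 rc.2 = k), add_comm]
  congr 2
  ext ⟨r, c⟩
  simp only [Finset.mem_filter, mem_cells]
  have hle := inter_le hm hi r
  unfold extT
  constructor
  · rintro ⟨h1, h2⟩
    have := hT.1 r c h2
    exact ⟨⟨by omega, by omega⟩, by rw [if_pos h2]; omega⟩
  · rintro ⟨⟨h1, h2⟩, h3⟩
    by_cases h : c < m r
    · refine ⟨?_, h⟩
      by_contra hh
      rw [hm r (by omega)] at h; omega
    · rw [if_neg h, if_pos h2] at h3; omega

lemma entry_ge (k : ℕ) {x : ℕ → ℕ} {T : ℕ → ℕ → ℕ} (hT : IsSSYT k x T) :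
    ∀ r c, c < x r → r ≤ T r c + 0 ∨ ∃ r' < r, ¬ c < x r' := by
  intro r
  induction r with
  | zero => intro c _; left; omega
  | succ r ih =>
    intro c hc
    by_cases h : c < x r
    · rcases ih c h with h' | ⟨r', h1, h2⟩
      · have := hT.2.2.2 r (r+1) c (by omega) hc
        left; omega
      · exact Or.inr ⟨r', by omega, h2⟩
    · exact Or.inr ⟨r, by omega, h⟩

lemma exists_ext {k : ℕ} {x : ℕ → ℕ} {T : ℕ → ℕ → ℕ} (hx : isPart (k+1) x)
    (hT : IsSSYT (k+1) x T) :
    ∃ m S, isVec k m ∧ Interl k m x ∧ IsSSYT k m S ∧ T = extT k x m S := by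
  have hge : ∀ r c, c < x r → r ≤ T r c := by
    intro r c hc
    rcases entry_ge _ hT r c hc with h | ⟨r', h1, h2⟩
    · exact h
    · have := hx.anti h1.le; omega
  obtain ⟨h1, h2, h3, h4⟩ := hT
  have key : ∀ r, ∃ n, ∀ c, c < n ↔ c < x r ∧ T r c < k := by
    intro r
    have hne : ∃ n, x r ≤ n ∨ k ≤ T r n := ⟨x r, Or.inl le_rfl⟩
    classical
    refine ⟨Nat.find hne, fun c => ?_⟩
    constructor
    · intro h
      have := Nat.find_min hne h
      push Not at this
      exact this
    · rintro ⟨ha, hb⟩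
      by_contra hc
      push Not at hc
      rcases Nat.find_spec hne with h | h
      · omega
      · have := h3 r _ c hc ha; omega
  choose m hmm using key
  have hle : ∀ r, m r ≤ x r := by
    intro r
    by_contra h
    have := (hmm r (x r)).1 (by omega)
    omega
  have hm : isVec k m := by
    intro r hr
    by_contra h
    have := (hmm r 0).1 (by omega)
    have := hge r 0 this.1
    omega
  have hi : Interl k m x := by
    intro r hr
    refine ⟨?_, hle r⟩
    by_contra h
    push Not at h
    have a := h4 r (r+1) (m r) (by omega) h
    have b := h1 (r+1) (m r) h
    have c := hx.anti (show r ≤ r+1 by omega)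
    have := (hmm r (m r)).2 ⟨by omega, by omega⟩
    omega
  refine ⟨m, fun r c => if c < m r then T r c else 0, hm, hi, ⟨?_, ?_, ?_, ?_⟩, ?_⟩
  · intro r c hc
    simp only [hc, if_true]
    exact ((hmm r c).1 hc).2
  · intro r c hc
    simp [hc]
  · intro r c c' hcc hc
    have := hle r
    simp only [hc, if_true, if_pos (lt_of_le_of_lt hcc hc)]
    exact h3 r c c' hcc (by omega)
  · intro r r' c hr hc
    have := hle r'
    have := (inter_part hm hi).anti hr.le
    simp only [hc, if_true, if_pos (show c < m r by omega)]
    exact h4 r r' c hr (by omega)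
  · funext r c
    unfold extT
    by_cases h : c < m r
    · simp [h]
    · by_cases h' : c < x r
      · simp only [h, h', if_true, if_false]
        have := h1 r c h'
        have := (hmm r c).not.1 h
        push Not at this
        have := this h'
        omega
      · simp only [h, h', if_false]
        exact h2 r c h'

lemma extT_inj {k : ℕ} {x m : ℕ → ℕ} :
    Set.InjOn (extT k x m) {S | IsSSYT k m S} := by
  intro S hS S' hS' h
  funext r c
  by_cases hc : c < m r
  · have := congrFun (congrFun h r) c
    simpa [extT, hc] using this
  · rw [hS.2.1 r c hc, hS'.2.1 r c hc]

lemma extT_shape {k : ℕ} {x m m' : ℕ → ℕ} {S S' : ℕ → ℕ → ℕ} (hm : isVec k m)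
    (hi : Interl k m x) (hS : IsSSYT k m S) (hm' : isVec k m')
    (hi' : Interl k m' x) (hS' : IsSSYT k m' S') (h : extT k x m S = extT k x m' S') : m = m' := by
  funext r
  apply le_antisymm
  · by_contra hh
    have := (extT_lt hm hi hS r (m' r)).1 (by omega)
    rw [h] at this
    have := (extT_lt hm' hi' hS' r (m' r)).2 this
    omega
  · by_contra hh
    have := (extT_lt hm' hi' hS' r (m r)).1 (by omega)
    rw [← h] at this
    have := (extT_lt hm hi hS r (m r)).2 this
    omega

lemma part_le {k : ℕ} {x : ℕ → ℕ} (hx : isPart k x) (r : ℕ) : x r ≤ x 0 := hx.anti (Nat.zero_le r)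

lemma ssyt_finite (k : ℕ) : ∀ x, isPart k x → {T | IsSSYT k x T}.Finite := by
  induction k with
  | zero =>
    intro x hx
    apply (Set.finite_singleton (fun _ _ => 0 : ℕ → ℕ → ℕ)).subset
    intro T hT
    simp only [Set.mem_singleton_iff]
    funext r c
    exact hT.2.1 r c (by rw [hx.2 r (by omega)]; omega)
  | succ k ih =>
    intro x hx
    have : (⋃ m ∈ {m | m ∈ boxF k (x 0) ∧ isPart k m}, extT k x m '' {S | IsSSYT k m S}).Finite := by
      apply Set.Finite.biUnion
      · exact (boxF k (x 0)).finite_toSet.subset (fun m hm => hm.1)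
      · intro m hm
        exact (ih m hm.2).image _
    apply this.subset
    intro T hT
    obtain ⟨m, S, hm, hi, hS, rfl⟩ := exists_ext hx hT
    simp only [Set.mem_iUnion]
    refine ⟨m, ⟨?_, inter_part hm hi⟩, S, hS, rfl⟩
    rw [mem_boxF]
    exact ⟨hm, fun r => le_trans (inter_le hm hi r) (part_le hx r)⟩

open Classical in
lemma branching (k N : ℕ) (x z : ℕ → ℕ) (hx : isPart (k+1) x) (hN : x 0 ≤ N) :
    kostka (k+1) x z = ∑ m ∈ boxF k N,
      if Interl k m x ∧ ∑ r ∈ Finset.range k, m r + z k = ∑ r ∈ Finset.range (k+1), x r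
      then kostka k m z else 0 := by
  rw [← Finset.sum_filter]
  set F := (boxF k N).filter (fun m => Interl k m x ∧
    ∑ r ∈ Finset.range k, m r + z k = ∑ r ∈ Finset.range (k+1), x r) with hF
  have hFm : ∀ m, m ∈ F → isVec k m ∧ Interl k m x ∧
      ∑ r ∈ Finset.range k, m r + z k = ∑ r ∈ Finset.range (k+1), x r := by
    intro m hm
    rw [hF, Finset.mem_filter, mem_boxF] at hm
    exact ⟨hm.1.1, hm.2⟩
  let A : (ℕ → ℕ) → Set (ℕ → ℕ → ℕ) := fun m =>
    {T | IsSSYT k m T ∧ ∀ i, i < k → entryCount k m T i = z i}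
  have hA : ∀ m ∈ F, (A m).Finite := fun m hm =>
    (ssyt_finite k m (inter_part (hFm m hm).1 (hFm m hm).2.1)).subset (fun T hT => hT.1)
  have hU : {T | IsSSYT (k+1) x T ∧ ∀ i, i < k+1 → entryCount (k+1) x T i = z i}
      = ⋃ m ∈ (F : Set (ℕ → ℕ)), extT k x m '' A m := by
    ext T
    simp only [Set.mem_iUnion, Set.mem_ofPred_eq, Set.mem_image, A]
    constructor
    · rintro ⟨hT, hw⟩
      obtain ⟨m, S, hm, hi, hS, rfl⟩ := exists_ext hx hT
      refine ⟨m, ?_, S, ⟨hS, ?_⟩, rfl⟩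
      · rw [Finset.mem_coe, hF, Finset.mem_filter, mem_boxF]
        refine ⟨⟨hm, fun r => ?_⟩, hi, ?_⟩
        · exact le_trans (le_trans (inter_le hm hi r) (part_le hx r)) hN
        · rw [← entry_top hm hi hS, hw k (by omega)]
      · intro i hik
        rw [← entry_lt hm hi hik]
        exact hw i (by omega)
    · rintro ⟨m, hmF, S, ⟨hS, hw⟩, rfl⟩
      obtain ⟨hm, hi, hs⟩ := hFm m hmF
      refine ⟨extT_ssyt hx hm hi hS, fun i hik => ?_⟩
      by_cases h : i < k
      · rw [entry_lt hm hi h]; exact hw i h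
      · have : i = k := by omega
        subst this
        have := entry_top hm hi hS
        omega
  unfold kostka
  rw [hU]
  have hfin : ∀ m ∈ F, (extT k x m '' A m).Finite := fun m hm => (hA m hm).image _
  rw [Set.Finite.ncard_biUnion F.finite_toSet hfin]
  · rw [finsum_mem_coe_finset]
    apply Finset.sum_congr rfl
    intro m hm
    exact Set.InjOn.ncard_image (extT_inj.mono (fun T hT => hT.1))
  · intro m hm m' hm' hne
    refine Set.disjoint_left.2 ?_
    rintro T ⟨S, hS, rfl⟩ ⟨S', hS', h⟩
    obtain ⟨a, b, c⟩ := hFm m hm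
    obtain ⟨a', b', c'⟩ := hFm m' hm'
    exact hne (extT_shape a b hS.1 a' b' hS'.1 h.symm)

def subE (x : ℕ → ℕ) (i : ℕ) : ℕ → ℕ := fun j => if j = i then x j - 1 else x j

lemma eq_addE_iff (z y : ℕ → ℕ) (i : ℕ) : z = addE y i ↔ 1 ≤ z i ∧ y = subE z i := by
  constructor
  · rintro rfl
    refine ⟨by simp [addE], ?_⟩
    funext j
    by_cases h : j = i <;> simp [addE, subE, h]
  · rintro ⟨h1, rfl⟩
    funext j
    by_cases h : j = i
    · subst h; simp [addE, subE]; omega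
    · simp [addE, subE, h]

lemma sum_addE (k : ℕ) (x : ℕ → ℕ) (i : ℕ) (hi : i < k) :
    ∑ r ∈ Finset.range k, addE x i r = ∑ r ∈ Finset.range k, x r + 1 := by
  have : ∀ r, addE x i r = x r + if r = i then 1 else 0 := by
    intro r; unfold addE; split_ifs <;> simp
  simp only [this, Finset.sum_add_distrib, Finset.sum_ite_eq', Finset.mem_range, hi, if_true]

lemma kostka_congr (k : ℕ) (x z z' : ℕ → ℕ) (h : ∀ i, i < k → z i = z' i) :
    kostka k x z = kostka k x z' := by
  unfold kostka
  congr 1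
  ext T
  simp only [Set.mem_ofPred_eq]
  refine and_congr_right fun _ => forall_congr' fun i => forall_congr' fun hi => ?_
  rw [h i hi]

open Classical in
lemma count_id (k : ℕ) (x v : ℕ → ℕ) (hx : isPart (k+1) x) (hv : isPart k v) :
    (∑ i ∈ Finset.range (k+1), if Interl k v (addE x i) then 1 else 0)
      = (if Interl k v x then 1 else 0) +
        ∑ j ∈ Finset.range k, if 1 ≤ v j ∧ Interl k (subE v j) x then 1 else 0 := by
  by_cases h : Interl k v x
  · rw [Finset.sum_range_succ', if_pos h, add_comm]
    congr 1
    · rw [if_pos]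
      intro r hr
      have := h r hr
      unfold addE
      rw [if_neg (by omega)]
      refine ⟨this.1, ?_⟩
      split_ifs <;> omega
    · apply Finset.sum_congr rfl
      intro j hj
      rw [Finset.mem_range] at hj
      have : Interl k v (addE x (j+1)) ↔ 1 ≤ v j ∧ Interl k (subE v j) x := by
        constructor
        · intro h'
          have a := (h' j hj).1
          simp only [addE, if_true] at a
          refine ⟨by omega, fun r hr => ?_⟩
          have := h r hr
          unfold subE
          split_ifs with hrj
          · subst hrj; omega
          · exact this
        · rintro ⟨h1, h'⟩ r hr
          have a := (h' j hj).1
          simp only [subE, if_true] at a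
          have b := h r hr
          unfold addE
          by_cases hrj : r = j
          · subst hrj
            rw [if_pos rfl, if_neg (by omega)]; omega
          · rw [if_neg (by omega)]
            split_ifs <;> omega
      simp only [this]
  · rw [Finset.sum_range_succ, if_neg h, if_neg, add_zero, zero_add]
    · apply Finset.sum_congr rfl
      intro j hj
      rw [Finset.mem_range] at hj
      have : Interl k v (addE x j) ↔ 1 ≤ v j ∧ Interl k (subE v j) x := by
        constructor
        · intro h'
          have hvj : v j = x j + 1 := by
            by_contra hne
            apply h
            intro r hr
            have a := h' r hr
            unfold addE at a
            by_cases hrj : r = j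
            · subst hrj; rw [if_neg (by omega), if_pos rfl] at a
              omega
            · rw [if_neg hrj] at a
              split_ifs at a <;> omega
          refine ⟨by omega, fun r hr => ?_⟩
          have a := h' r hr
          unfold addE at a
          unfold subE
          by_cases hrj : r = j
          · subst hrj
            have := hx.anti (show r ≤ r+1 by omega)
            rw [if_pos rfl]; omega
          · rw [if_neg hrj] at a ⊢
            split_ifs at a <;> omega
        · rintro ⟨h1, h'⟩
          have hvj : v j = x j + 1 := by
            by_contra hne
            apply h
            intro r hr
            have a := h' r hr
            unfold subE at a
            by_cases hrj : r = j
            · subst hrj; rw [if_pos rfl] at a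
              omega
            · rw [if_neg hrj] at a
              exact a
          intro r hr
          have a := h' r hr
          unfold subE at a
          unfold addE
          by_cases hrj : r = j
          · subst hrj
            rw [if_pos rfl] at a ⊢
            rw [if_neg (by omega)]; omega
          · rw [if_neg hrj] at a ⊢
            split_ifs with h2
            · have := hv.anti (show r ≤ r + 1 by omega)
              rw [h2] at this
              rw [h2]
              omega
            · exact a
      simp only [this]
    · intro h'
      apply h
      intro r hr
      have a := h' r hr
      unfold addE at a
      rw [if_neg (show r ≠ k by omega)] at a
      split_ifs at a <;> omega

lemma isVec_addE {k : ℕ} {x : ℕ → ℕ} {i : ℕ} (hx : isVec k x) (hi : i < k) :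
    isVec k (addE x i) := by
  intro j hj
  unfold addE
  rw [if_neg (by omega)]; exact hx j hj

lemma isVec_subE {k : ℕ} {x : ℕ → ℕ} {i : ℕ} (hx : isVec k x) : isVec k (subE x i) := by
  intro j hj
  unfold subE
  have := hx j hj
  split_ifs <;> omega

open Classical in
lemma pieri (k : ℕ) : ∀ (x z : ℕ → ℕ), isPart k x →
    (∑ i ∈ Finset.range k, if isPart k (addE x i) then kostka k (addE x i) z else 0)
      = ∑ i ∈ Finset.range k, if 1 ≤ z i then kostka k x (subE z i) else 0 := by
  induction k with
  | zero => intro x z _; simp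
  | succ k ih =>
    intro x z hx
    set N := x 0 + 1 with hN
    set X := ∑ r ∈ Finset.range (k+1), x r with hX
    -- left side
    have hL : (∑ i ∈ Finset.range (k+1),
        if isPart (k+1) (addE x i) then kostka (k+1) (addE x i) z else 0)
        = ∑ v ∈ boxF k N, (if isPart k v ∧ ∑ r ∈ Finset.range k, v r + z k = X + 1
            then kostka k v z else 0) *
          ∑ i ∈ Finset.range (k+1), (if Interl k v (addE x i) then 1 else 0) := by
      simp only [Finset.mul_sum]
      rw [Finset.sum_comm]
      apply Finset.sum_congr rfl
      intro i hi
      rw [Finset.mem_range] at hi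
      by_cases hp : isPart (k+1) (addE x i)
      · rw [if_pos hp, branching k N _ z hp (by unfold addE; split_ifs <;> omega)]
        apply Finset.sum_congr rfl
        intro v hv
        rw [mem_boxF] at hv
        rw [sum_addE _ _ _ hi]
        by_cases hint : Interl k v (addE x i)
        · have := inter_part hv.1 hint
          simp [hint, this, hX]
        · simp [hint]
      · rw [if_neg hp, eq_comm]
        apply Finset.sum_eq_zero
        intro v hv
        have hni : ¬ Interl k v (addE x i) := fun hint =>
          hp (inter_part' (isVec_addE hx.2 hi) hint)
        rw [if_neg hni, mul_zero]
    have hM : ∀ v ∈ boxF k N, (if isPart k v ∧ ∑ r ∈ Finset.range k, v r + z k = X + 1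
            then kostka k v z else 0) *
          ∑ i ∈ Finset.range (k+1), (if Interl k v (addE x i) then 1 else 0)
        = (if Interl k v x ∧ ∑ r ∈ Finset.range k, v r + z k = X + 1 then kostka k v z else 0)
          + ∑ j ∈ Finset.range k, if 1 ≤ v j ∧ Interl k (subE v j) x ∧ isPart k v ∧
              ∑ r ∈ Finset.range k, v r + z k = X + 1 then kostka k v z else 0 := by
      intro v hv
      rw [mem_boxF] at hv
      by_cases hp : isPart k v
      · rw [count_id k x v hx hp, mul_add, Finset.mul_sum]
        congr 1
        · by_cases h : Interl k v x <;> simp [h, hp]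
        · apply Finset.sum_congr rfl
          intro j _
          by_cases h : 1 ≤ v j ∧ Interl k (subE v j) x
          · simp only [h, hp, true_and, if_true, mul_one]
          · rw [if_neg h, mul_zero, if_neg (fun h' => h ⟨h'.1, h'.2.1⟩)]
      · have hni : ¬ Interl k v x := fun h => hp (inter_part hv.1 h)
        simp [hp, hni]
    rw [hL, Finset.sum_congr rfl hM, Finset.sum_add_distrib, Finset.sum_range_succ, add_comm]
    congr 1
    · -- lower terms
      have hR : ∀ i ∈ Finset.range k, (if 1 ≤ z i then kostka (k+1) x (subE z i) else 0)
          = ∑ m ∈ boxF k N, if Interl k m x ∧ ∑ r ∈ Finset.range k, m r + z k = X then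
              (if 1 ≤ z i then kostka k m (subE z i) else 0) else 0 := by
        intro i hi
        rw [Finset.mem_range] at hi
        have hzk : subE z i k = z k := by unfold subE; rw [if_neg (by omega)]
        rw [branching k N x (subE z i) hx (by omega), hzk]
        by_cases h : 1 ≤ z i
        · simp only [h, if_true, hX]
        · simp [h]
      rw [Finset.sum_congr rfl hR, Finset.sum_comm (s := Finset.range k) (t := boxF k N)]
      have hR2 : ∀ m ∈ boxF k N, (∑ i ∈ Finset.range k,
            if Interl k m x ∧ ∑ r ∈ Finset.range k, m r + z k = X then
              (if 1 ≤ z i then kostka k m (subE z i) else 0) else 0)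
          = ∑ j ∈ Finset.range k, if Interl k m x ∧ ∑ r ∈ Finset.range k, m r + z k = X then
              (if isPart k (addE m j) then kostka k (addE m j) z else 0) else 0 := by
        intro m hm
        rw [mem_boxF] at hm
        by_cases h : Interl k m x ∧ ∑ r ∈ Finset.range k, m r + z k = X
        · simp only [h, and_self, if_true]
          exact (ih m z (inter_part hm.1 h.1)).symm
        · simp [h]
      rw [Finset.sum_congr rfl hR2]
      refine (Finset.sum_comm.trans ?_).trans Finset.sum_comm
      apply Finset.sum_congr rfl
      intro j hj
      rw [Finset.mem_range] at hj
      simp only [← ite_and]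
      rw [← Finset.sum_filter, ← Finset.sum_filter]
      symm
      refine Finset.sum_nbij' (fun m => addE m j) (fun v => subE v j) ?_ ?_ ?_ ?_ ?_
      · intro m hm
        rw [Finset.mem_filter, mem_boxF] at hm
        obtain ⟨⟨h1, h2⟩, ⟨h3, h4⟩, h5⟩ := hm
        have hs := (eq_addE_iff (addE m j) m j).1 rfl
        rw [Finset.mem_filter, mem_boxF]
        refine ⟨⟨h5.2, fun r => ?_⟩, hs.1, by rw [← hs.2]; exact h3, h5, ?_⟩
        · have a := inter_le h1 h3 r
          have b := part_le hx r
          unfold addE; split_ifs <;> omega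
        · rw [sum_addE _ _ _ hj]; omega
      · intro v hv
        rw [Finset.mem_filter, mem_boxF] at hv
        obtain ⟨⟨h1, h2⟩, h3, h4, h5, h6⟩ := hv
        have hs := (eq_addE_iff v (subE v j) j).2 ⟨h3, rfl⟩
        rw [Finset.mem_filter, mem_boxF]
        refine ⟨⟨isVec_subE h1, fun r => ?_⟩, ⟨h4, ?_⟩, by rw [← hs]; exact h5⟩
        · have := h2 r
          unfold subE; split_ifs <;> omega
        · have := sum_addE k (subE v j) j hj
          rw [← hs] at this; omega
      · intro m hm
        exact ((eq_addE_iff (addE m j) m j).1 rfl).2.symm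
      · intro v hv
        rw [Finset.mem_filter] at hv
        exact ((eq_addE_iff v (subE v j) j).2 ⟨hv.2.1, rfl⟩).symm
      · intro m hm
        rfl
    · -- top term
      by_cases hz : 1 ≤ z k
      · rw [if_pos hz, branching k N x (subE z k) hx (by omega)]
        apply Finset.sum_congr rfl
        intro v hv
        have e : kostka k v (subE z k) = kostka k v z := by
          apply kostka_congr
          intro i hi
          unfold subE; rw [if_neg (by omega)]
        have e2 : subE z k k = z k - 1 := by simp [subE]
        rw [e, e2]
        have : (∑ r ∈ Finset.range k, v r + z k = X + 1) ↔
          (∑ r ∈ Finset.range k, v r + (z k - 1) = X) := by omega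
        simp only [this, ← hX]
      · rw [if_neg hz]
        apply Finset.sum_eq_zero
        intro v hv
        rw [mem_boxF] at hv
        rw [if_neg]
        rintro ⟨h1, h2⟩
        have a : ∑ r ∈ Finset.range k, v r ≤ ∑ r ∈ Finset.range k, x r :=
          Finset.sum_le_sum fun r _ => inter_le hv.1 h1 r
        rw [hX, Finset.sum_range_succ] at h2
        omega

lemma schur_pos (k : ℕ) (p : ℕ → ℝ) (hp : ∀ i, i < k → 0 < p i) (y z : ℕ → ℕ)
    (hy : isPart k y) (h : kostka k y z ≠ 0) : schur k y p ≠ 0 := by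
  have hne := Set.nonempty_of_ncard_ne_zero h
  obtain ⟨T, hT, _⟩ := hne
  have : Finite {T : ℕ → ℕ → ℕ // IsSSYT k y T} := (ssyt_finite k y hy).to_subtype
  have := Fintype.ofFinite {T : ℕ → ℕ → ℕ // IsSSYT k y T}
  unfold schur
  rw [tsum_fintype]
  apply ne_of_gt
  apply Finset.sum_pos
  · intro S _
    exact Finset.prod_pos fun i hi => pow_pos (hp i (Finset.mem_range.1 hi)) _
  · exact ⟨⟨T, hT⟩, Finset.mem_univ _⟩

lemma prod_addE (k : ℕ) (p : ℕ → ℝ) (y : ℕ → ℕ) (i : ℕ) (hi : i < k) :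
    ∏ r ∈ Finset.range k, p r ^ addE y i r = (∏ r ∈ Finset.range k, p r ^ y r) * p i := by
  have : ∀ r, p r ^ addE y i r = p r ^ y r * if r = i then p r else 1 := by
    intro r; unfold addE; split_ifs <;> simp [pow_succ]
  simp only [this, Finset.prod_mul_distrib, Finset.prod_ite_eq', Finset.mem_range, hi, if_true]

lemma tsum_pred {P : (ℕ → ℕ) → Prop} {f : (ℕ → ℕ) → ℝ} (h : ∀ y, f y ≠ 0 → P y) :
    ∑' y : {y // P y}, f y.1 = ∑' y, f y :=
  Function.Injective.tsum_eq (g := fun y : {y // P y} => y.1) Subtype.val_injective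
    (fun y hy => ⟨⟨y, h y hy⟩, rfl⟩)

/-- intertwining `QK = KP`: for every `x ∈ C` and `z ∈ ℤ_+^k`,
`∑_{y∈C} Q(x,y)K(y,z) = ∑_{y∈ℤ_+^k} K(x,y)P(y,z)`, both sums having finitely
many nonzero terms. -/
theorem stmt16 (k : ℕ) (hk : 1 ≤ k) (p : ℕ → ℝ) (hp : ∀ i, i < k → 0 < p i)
    (x z : ℕ → ℕ) (hx : isPart k x) (hz : isVec k z) :
    {y : ℕ → ℕ | isPart k y ∧ Qker k p x y * Kker k p y z ≠ 0}.Finite ∧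
    {y : ℕ → ℕ | isVec k y ∧ Kker k p x y * Pker k p y z ≠ 0}.Finite ∧
    ∑' y : {y : ℕ → ℕ // isPart k y}, Qker k p x y.1 * Kker k p y.1 z
      = ∑' y : {y : ℕ → ℕ // isVec k y}, Kker k p x y.1 * Pker k p y.1 z := by

  classical
  set A : ℝ := (∏ i ∈ Finset.range k, p i ^ z i) / schur k x p with hA
  have hQ : ∀ y, isPart k y → Qker k p x y * Kker k p y z =
      ∑ i ∈ Finset.range k, if y = addE x i then
        A * ((if isPart k (addE x i) then kostka k (addE x i) z else 0 : ℕ) : ℝ) else 0 := by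
    intro y hy
    have h1 : Qker k p x y * Kker k p y z = A * (kostka k y z : ℝ) *
        ∑ i ∈ Finset.range k, if y = addE x i then 1 else 0 := by
      unfold Qker Kker
      by_cases h : kostka k y z = 0
      · simp [h]
      · have := schur_pos k p hp y z hy h
        rw [hA]
        field_simp
    rw [h1, Finset.mul_sum]
    apply Finset.sum_congr rfl
    intro i _
    by_cases h : y = addE x i
    · rw [if_pos h, if_pos h, ← h, if_pos hy, mul_one]
    · rw [if_neg h, if_neg h, mul_zero]
  have hP : ∀ y, Kker k p x y * Pker k p y z =
      ∑ i ∈ Finset.range k, if y = subE z i then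
        A * ((if 1 ≤ z i then kostka k x (subE z i) else 0 : ℕ) : ℝ) else 0 := by
    intro y
    unfold Kker Pker
    rw [Finset.mul_sum]
    apply Finset.sum_congr rfl
    intro i hi
    rw [Finset.mem_range] at hi
    by_cases h : z = addE y i
    · have h' := (eq_addE_iff z y i).1 h
      have hpr := prod_addE k p y i hi
      rw [← h] at hpr
      rw [if_pos h, if_pos h'.2, if_pos h'.1, hA, hpr, ← h'.2]
      ring
    · rw [if_neg h]
      by_cases h2 : y = subE z i
      · rw [if_pos h2, if_neg (fun h1 => h ((eq_addE_iff z y i).2 ⟨h1, h2⟩))]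
        simp
      · rw [if_neg h2]; simp
  refine ⟨?_, ?_, ?_⟩
  · apply ((Finset.range k).image (addE x)).finite_toSet.subset
    rintro y ⟨hy, hne⟩
    rw [hQ y hy] at hne
    obtain ⟨i, hi, h⟩ := Finset.exists_ne_zero_of_sum_ne_zero hne
    rw [Finset.mem_coe, Finset.mem_image]
    refine ⟨i, hi, ?_⟩
    by_contra hh
    exact h (if_neg (fun h' => hh h'.symm))
  · apply ((Finset.range k).image (subE z)).finite_toSet.subset
    rintro y ⟨hy, hne⟩
    rw [hP y] at hne
    obtain ⟨i, hi, h⟩ := Finset.exists_ne_zero_of_sum_ne_zero hne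
    rw [Finset.mem_coe, Finset.mem_image]
    refine ⟨i, hi, ?_⟩
    by_contra hh
    exact h (if_neg (fun h' => hh h'.symm))
  · have e1 : ∑' y : {y : ℕ → ℕ // isPart k y}, Qker k p x y.1 * Kker k p y.1 z
        = ∑ i ∈ Finset.range k,
          A * ((if isPart k (addE x i) then kostka k (addE x i) z else 0 : ℕ) : ℝ) := by
      have hs := hasSum_sum (s := Finset.range k) (fun i _ => hasSum_ite_eq (addE x i)
        (A * ((if isPart k (addE x i) then kostka k (addE x i) z else 0 : ℕ) : ℝ)))
      rw [← hs.tsum_eq]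
      rw [tsum_congr (fun y : {y : ℕ → ℕ // isPart k y} => hQ y.1 y.2)]
      refine tsum_pred (P := isPart k) (f := fun y => ∑ i ∈ Finset.range k, if y = addE x i then
        A * ((if isPart k (addE x i) then kostka k (addE x i) z else 0 : ℕ) : ℝ) else 0) ?_
      intro y hne
      obtain ⟨i, hi, h⟩ := Finset.exists_ne_zero_of_sum_ne_zero hne
      by_contra hh
      apply h
      by_cases h2 : y = addE x i
      · have : ¬ isPart k (addE x i) := fun h3 => hh (by rw [h2]; exact h3)
        simp [this]
      · simp [h2]
    have e2 : ∑' y : {y : ℕ → ℕ // isVec k y}, Kker k p x y.1 * Pker k p y.1 z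
        = ∑ i ∈ Finset.range k,
          A * ((if 1 ≤ z i then kostka k x (subE z i) else 0 : ℕ) : ℝ) := by
      have hs := hasSum_sum (s := Finset.range k) (fun i _ => hasSum_ite_eq (subE z i)
        (A * ((if 1 ≤ z i then kostka k x (subE z i) else 0 : ℕ) : ℝ)))
      rw [← hs.tsum_eq]
      rw [tsum_congr (fun y : {y : ℕ → ℕ // isVec k y} => hP y.1)]
      refine tsum_pred (P := isVec k) (f := fun y => ∑ i ∈ Finset.range k, if y = subE z i then
        A * ((if 1 ≤ z i then kostka k x (subE z i) else 0 : ℕ) : ℝ) else 0) ?_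
      intro y hne
      obtain ⟨i, hi, h⟩ := Finset.exists_ne_zero_of_sum_ne_zero hne
      by_cases h2 : y = subE z i
      · rw [h2]; exact isVec_subE hz
      · exact absurd (if_neg h2) h
    rw [e1, e2, ← Finset.mul_sum, ← Finset.mul_sum]
    congr 1
    exact_mod_cast pieri k x z hx
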